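/- The second difference of primes takes negative values infinitely often; that is, there are infinitely many n with p_{n+2} - 2·p_{n+1} + p_n < 0. -/

import Mathlib

/-- `p n` is the n-th prime, with `p 1 = 2`. -/
noncomputable def p (n : ℕ) : ℕ := Nat.nth Nat.Prime (n - 1)

lemma exists_small_nondiv (g : ℕ) (hg : 0 < g) :
    ∃ r, r.Prime ∧ ¬ r ∣ g ∧ r ≤ 4 * (Nat.sqrt g + 1) := by
  obtain ⟨r1, hp1, h1, h1'⟩ := Nat.exists_prime_lt_and_le_two_mul (Nat.sqrt g + 1) (by omega)
  obtain ⟨r2, hp2, h2, h2'⟩ := Nat.exists_prime_lt_and_le_two_mul r1 hp1.pos.ne'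
  by_cases hd1 : r1 ∣ g
  · by_cases hd2 : r2 ∣ g
    · exfalso
      have hc : Nat.Coprime r1 r2 := (Nat.coprime_primes hp1 hp2).2 (by omega)
      have hle := Nat.le_of_dvd hg (hc.mul_dvd_of_dvd_of_dvd hd1 hd2)
      have := Nat.lt_succ_sqrt g
      simp only [Nat.succ_eq_add_one] at this
      nlinarith
    · exact ⟨r2, hp2, hd2, by omega⟩
  · exact ⟨r1, hp1, hd1, by omega⟩

lemma no_long_run (q g r : ℕ) (hr : r.Prime) (hd : ¬ r ∣ g) (hrq : r < q)
    (h : ∀ i < r, (q + i * g).Prime) : False := by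
  have := Fact.mk hr
  have hg : (g : ZMod r) ≠ 0 := by
    rwa [Ne, ZMod.natCast_eq_zero_iff]
  let x : ZMod r := -(q : ZMod r) / g
  have hx : r ∣ q + x.val * g := by
    rw [← ZMod.natCast_eq_zero_iff]
    push_cast
    rw [ZMod.natCast_zmod_val]
    simp only [x]
    field_simp
    ring
  have h2 := (Nat.prime_dvd_prime_iff_eq hr (h _ (ZMod.val_lt x))).1 hx
  have : 0 ≤ x.val * g := Nat.zero_le _
  omega

lemma core (P h : ℕ → ℕ) (hP : ∀ k, (P k).Prime) (hbig : ∀ k, 100 ≤ P k)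
    (hh : ∀ k, P (k + 1) = P k + h k) (hpos : ∀ k, 0 < h k) (hmono : Monotone h)
    (hB : ∀ k, h k ≤ P k) (K : ℕ) : K * K ≤ 64 * (h K) ^ 3 := by
  have hfib : ∀ g ∈ Finset.Icc 1 (h K),
      ((Finset.range K).filter (fun k => h k = g)).card ≤ 8 * Nat.sqrt (h K) := by
    intro g hg
    rw [Finset.mem_Icc] at hg
    obtain ⟨r, hr, hd, hle⟩ := exists_small_nondiv g (by omega)
    have hs : Nat.sqrt g ≤ Nat.sqrt (h K) := Nat.sqrt_le_sqrt hg.2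
    have hs1 : 1 ≤ Nat.sqrt (h K) := by
      rw [Nat.le_sqrt]; omega
    set S := (Finset.range K).filter (fun k => h k = g) with hS
    rcases S.eq_empty_or_nonempty with he | hne
    · rw [he]; simp
    have hsub : S ⊆ Finset.Ico (S.min' hne) (S.min' hne + r) := by
      intro x hx
      have hax := S.min'_le x hx
      rw [Finset.mem_Ico]
      refine ⟨hax, ?_⟩
      by_contra hcon
      have ha := S.min'_mem hne
      set a := S.min' hne
      have hag : h a = g := (Finset.mem_filter.1 ha).2
      have hxg : h x = g := (Finset.mem_filter.1 hx).2
      have hrun : ∀ i ≤ r, P (a + i) = P a + i * g := by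
        intro i
        induction i with
        | zero => simp
        | succ i ih =>
          intro hi
          have e1 : h (a + i) = g := by
            apply le_antisymm
            · rw [← hxg]; exact hmono (by omega)
            · rw [← hag]; exact hmono (by omega)
          rw [← add_assoc, hh, ih (by omega), e1]; ring
      have hgP : g ≤ P a := by rw [← hag]; exact hB a
      have hsq : Nat.sqrt g * Nat.sqrt g ≤ g := Nat.sqrt_le g
      have hb := hbig a
      have hrP : r < P a := by
        rcases le_or_gt (Nat.sqrt g) 8 with h8 | h8
        · omega
        · nlinarith
      refine no_long_run (P a) g r hr hd hrP ?_
      intro i hi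
      rw [← hrun i hi.le]
      exact hP _
    have := Finset.card_le_card hsub
    rw [Nat.card_Ico] at this
    omega
  have hc := Finset.card_le_mul_card_image_of_maps_to (f := h) (s := Finset.range K)
    (t := Finset.Icc 1 (h K)) (by
      intro k hk
      have hk' : k < K := by simpa using hk
      exact Finset.mem_coe.2 (Finset.mem_Icc.2 ⟨hpos k, hmono hk'.le⟩)) _ hfib
  simp only [Finset.card_range, Nat.card_Icc, Nat.add_sub_cancel] at hc
  have hsq : Nat.sqrt (h K) * Nat.sqrt (h K) ≤ h K := Nat.sqrt_le _
  calc K * K ≤ (8 * Nat.sqrt (h K) * h K) * (8 * Nat.sqrt (h K) * h K) := Nat.mul_le_mul hc hc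
    _ = 64 * (h K) ^ 2 * (Nat.sqrt (h K) * Nat.sqrt (h K)) := by ring
    _ ≤ 64 * (h K) ^ 2 * h K := Nat.mul_le_mul_left _ hsq
    _ = _ := by ring

lemma core_summable (P h : ℕ → ℕ) (hP : ∀ k, (P k).Prime) (hbig : ∀ k, 100 ≤ P k)
    (hh : ∀ k, P (k + 1) = P k + h k) (hpos : ∀ k, 0 < h k) (hmono : Monotone h)
    (hB : ∀ k, h k ≤ P k) : Summable (fun k => (1 : ℝ) / P k) := by
  have hPm : Monotone P := monotone_nat_of_le_succ (fun k => by rw [hh]; omega)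
  have hlow : ∀ K, K * h K ≤ P (2 * K) := by
    intro K
    have : ∀ i, i * h K ≤ P (K + i) := by
      intro i
      induction i with
      | zero => simp
      | succ i ih =>
        rw [← add_assoc, hh, add_mul, one_mul]
        exact Nat.add_le_add ih (hmono (by omega))
    rw [two_mul]; exact this K
  have hbound : ∀ K : ℕ, ((K : ℝ)) ^ (5 / 3 : ℝ) / 4 ≤ P (2 * K) := by
    intro K
    have h1 := core P h hP hbig hh hpos hmono hB K
    have h1' : (K : ℝ) ^ 2 ≤ 64 * (h K : ℝ) ^ 3 := by
      rw [sq]; exact_mod_cast h1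
    have h2 : (K : ℝ) * h K ≤ P (2 * K) := by exact_mod_cast hlow K
    refine le_trans ?_ h2
    have hK0 : (0 : ℝ) ≤ K := Nat.cast_nonneg _
    have hH0 : (0 : ℝ) ≤ h K := Nat.cast_nonneg _
    apply le_of_pow_le_pow_left₀ (n := 3) (by norm_num) (by positivity)
    have e : ((K : ℝ) ^ (5 / 3 : ℝ)) ^ 3 = (K : ℝ) ^ 5 := by
      rw [← Real.rpow_natCast, ← Real.rpow_mul hK0, ← Real.rpow_natCast]
      norm_num
    rw [div_pow, e, mul_pow]
    have : (K : ℝ) ^ 3 * (K : ℝ) ^ 2 ≤ (K : ℝ) ^ 3 * (64 * (h K : ℝ) ^ 3) := by gcongr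
    nlinarith
  have hs : Summable (fun K : ℕ => 4 * (1 / (K : ℝ) ^ (5 / 3 : ℝ))) :=
    (Real.summable_one_div_nat_rpow.2 (by norm_num)).mul_left 4
  have key : ∀ e : ℕ → ℕ, (∀ K, 2 * K ≤ e K) → Summable (fun K => (1 : ℝ) / P (e K)) := by
    intro e he
    rw [← summable_nat_add_iff 1]
    refine Summable.of_nonneg_of_le (fun K => by positivity) ?_ ((summable_nat_add_iff 1).2 hs)
    intro K
    have h1 := hbound (K + 1)
    have h2 : (P (2 * (K + 1)) : ℝ) ≤ P (e (K + 1)) := by exact_mod_cast hPm (he _)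
    have h3 : (0 : ℝ) < ((K + 1 : ℕ) : ℝ) ^ (5 / 3 : ℝ) := by positivity
    calc (1 : ℝ) / P (e (K + 1)) ≤ 1 / (((K + 1 : ℕ) : ℝ) ^ (5 / 3 : ℝ) / 4) :=
          one_div_le_one_div_of_le (by positivity) (h1.trans h2)
      _ = _ := by field_simp
  have k1 := key (fun K => 2 * K) (fun K => le_rfl)
  have k2 := key (fun K => 2 * K + 1) (fun K => by omega)
  generalize hf : (fun k => (1 : ℝ) / P k) = f
  have k1' : Summable (fun K => f (2 * K)) := by rw [← hf]; exact k1
  have k2' : Summable (fun K => f (2 * K + 1)) := by rw [← hf]; exact k2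
  exact (HasSum.even_add_odd k1'.hasSum k2'.hasSum).summable

theorem second_diff_neg_infinitely_often :
    {n : ℕ | (p (n + 2) : ℤ) - 2 * p (n + 1) + p n < 0}.Infinite := by
  intro hfin
  obtain ⟨N, hN⟩ := hfin.bddAbove
  set M := N + 100 with hM
  let P : ℕ → ℕ := fun k => Nat.nth Nat.Prime (M + k)
  have hP : ∀ k, (P k).Prime := fun k => Nat.prime_nth_prime _
  have hsm : StrictMono (Nat.nth Nat.Prime) := Nat.nth_strictMono Nat.infinite_setOfPred_prime
  have hlt : ∀ k, P k < P (k + 1) := fun k => hsm (by omega)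
  have hbig : ∀ k, 100 ≤ P k := fun k => le_trans (by omega) (hsm.le_apply (x := M + k))
  have hd : ∀ k, 2 * P (k + 1) ≤ P (k + 2) + P k := by
    intro k
    by_contra hcon
    have hmem : M + k + 1 ∈ {n : ℕ | (p (n + 2) : ℤ) - 2 * p (n + 1) + p n < 0} := by
      have e0 : p (M + k + 1) = P k := rfl
      have e1 : p (M + k + 1 + 1) = P (k + 1) := rfl
      have e2 : p (M + k + 1 + 2) = P (k + 2) := rfl
      simp only [Set.mem_ofPred_eq, e0, e1, e2]
      omega
    have := hN hmem
    omega
  have hsum : Summable (fun k => (1 : ℝ) / P k) := by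
    refine core_summable P (fun k => P (k + 1) - P k) hP hbig ?_ ?_ ?_ ?_
    · intro k; have := hlt k; omega
    · intro k; have := hlt k; omega
    · refine monotone_nat_of_le_succ (fun k => ?_)
      have h1 := hlt k
      have h2 := hlt (k + 1)
      have h3 := hd k
      rw [show k + 1 + 1 = k + 2 from rfl] at *
      omega
    · intro k
      obtain ⟨r, hr, h1, h2⟩ := Nat.exists_prime_lt_and_le_two_mul (P k) (hP k).pos.ne'
      have : P (k + 1) ≤ r := by
        by_contra hcon
        have := Nat.le_nth_of_lt_nth_succ (p := Nat.Prime) (k := M + k) (not_le.1 hcon) hr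
        exact absurd this (not_le.2 h1)
      omega
  have hsum2 : Summable (fun k => (1 : ℝ) / Nat.nth Nat.Prime k) := by
    rw [← summable_nat_add_iff M]
    simpa only [P, add_comm] using hsum
  apply Nat.Primes.not_summable_one_div
  have hinj : Function.Injective (fun q : Nat.Primes => Nat.count Nat.Prime (q : ℕ)) := by
    intro a b hab
    exact Subtype.ext (Nat.count_injective a.2 b.2 hab)
  have := hsum2.comp_injective hinj
  refine this.congr ?_
  intro q
  simp only [Function.comp]
  rw [Nat.nth_count q.2]
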